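/- For the two-dimensional L×L grid graph G, the separation profile satisfies s_G(r) = O(√r) for all 1 ≤ r ≤ L². More generally, the D-dimensional grid of side L satisfies s_G(r) = O(r^{1−1/D}). -/

import Mathlib

open scoped Classical ComplexOrder
open Finset

/-- Outer boundary: vertices outside `U` adjacent to some vertex of `U`. -/
noncomputable def outerBoundary {V : Type*} [Fintype V] (G : SimpleGraph V) (U : Finset V) :
    Finset V :=
  Finset.univ.filter fun v => v ∉ U ∧ ∃ u ∈ U, G.Adj u v

/-- Inner boundary: vertices of `U` adjacent to some vertex outside `U`. -/
noncomputable def innerBoundary {V : Type*} [Fintype V] (G : SimpleGraph V) (U : Finset V) :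
    Finset V :=
  Finset.univ.filter fun u => u ∈ U ∧ ∃ v, v ∉ U ∧ G.Adj u v

/-- Two vertex sets are disconnected: no edge of `G` joins them. -/
def Disconn {V : Type*} (G : SimpleGraph V) (A B : Finset V) : Prop :=
  ∀ a ∈ A, ∀ b ∈ B, ¬ G.Adj a b

/-- A `d`-correctable family of a graph `G`: closed under subsets (Trivial), contains all
sets of size `< d` (Distance), closed under unions of pairwise disjoint pairwise
disconnected members (Union), and closed under expansion (Expansion). -/
def IsCorrectableFamily {V : Type*} [Fintype V] [DecidableEq V] (G : SimpleGraph V) (d : ℕ)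
    (F : Set (Finset V)) : Prop :=
  (∀ U ∈ F, ∀ W ⊆ U, W ∈ F) ∧
  (∀ U : Finset V, U.card < d → U ∈ F) ∧
  (∀ (ℓ : ℕ) (U : Fin ℓ → Finset V), (∀ i, U i ∈ F) →
    (∀ i j, i ≠ j → Disjoint (U i) (U j) ∧ Disconn G (U i) (U j)) →
    Finset.univ.biUnion U ∈ F) ∧
  (∀ U ∈ F, ∀ T ∈ F, outerBoundary G U ⊆ T → U ∪ T ∈ F)

/-- A set is `d`-correctable with respect to `G` if it belongs to every
`d`-correctable family of `G`. -/
def IsCorrectableSet {V : Type*} [Fintype V] [DecidableEq V] (G : SimpleGraph V) (d : ℕ)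
    (U : Finset V) : Prop :=
  ∀ F : Set (Finset V), IsCorrectableFamily G d F → U ∈ F

/-- The (induced subgraph on) `H` admits a 2/3-balanced separator of size at most `t`. -/
def SepUpTo {V : Type*} [DecidableEq V] (G : SimpleGraph V) (H : Finset V) (t : ℝ) : Prop :=
  ∃ T U₁ U₂ : Finset V, T ∪ U₁ ∪ U₂ = H ∧
    Disjoint T U₁ ∧ Disjoint T U₂ ∧ Disjoint U₁ U₂ ∧
    Disconn G U₁ U₂ ∧
    3 * U₁.card ≤ 2 * H.card ∧ 3 * U₂.card ≤ 2 * H.card ∧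
    (T.card : ℝ) ≤ t

/-- `G` has separation profile `s_G(r) ≤ β · r^c` for all `r`: every vertex subset `H`
admits a 2/3-balanced separator of size at most `β · |H|^c`. -/
def HasSepProfile {V : Type*} [DecidableEq V] (G : SimpleGraph V) (β c : ℝ) : Prop :=
  ∀ H : Finset V, SepUpTo G H (β * (H.card : ℝ) ^ c)

/-- `A` is a union of pairwise disjoint, pairwise disconnected components,
each of size at most `d - 1`. -/
def SmallComponents {V : Type*} [DecidableEq V] (G : SimpleGraph V) (d : ℕ)
    (A : Finset V) : Prop :=
  ∃ (ℓ : ℕ) (U : Fin ℓ → Finset V), A = Finset.univ.biUnion U ∧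
    (∀ i, (U i).card < d) ∧
    ∀ i j, i ≠ j → Disjoint (U i) (U j) ∧ Disconn G (U i) (U j)

/-- The `D`-dimensional grid graph of side `L`: vertices `{0,...,L-1}^D`, edges between
vertices at ℓ₁-distance 1. -/
noncomputable def gridGraph (D L : ℕ) : SimpleGraph (Fin D → Fin L) :=
  SimpleGraph.fromRel fun u v => (∑ i, Nat.dist (u i : ℕ) (v i : ℕ)) = 1

/-- If the fibres over `s` of a labelling of `A` each have at most `n / 3` elements, some subset of
`s` has total weight at most `2n / 3` and either exhausts `s` or has weight at least `n / 3`. -/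
theorem exists_balanced_labels {V ι : Type*} (A : Finset V) (f : V → ι) (n : ℕ)
    (hf : ∀ c, 3 * (A.filter fun v => f v = c).card ≤ n) (s : Finset ι) :
    ∃ S : Finset ι, 3 * (A.filter fun v => f v ∈ S).card ≤ 2 * n ∧
      (S = s ∨ n ≤ 3 * (A.filter fun v => f v ∈ S).card) := by
  induction s using Finset.induction_on with
  | empty => exact ⟨∅, by simp, Or.inl rfl⟩
  | insert c s _ ih =>
    obtain ⟨S, hS, hs⟩ := ih
    by_cases hn : n ≤ 3 * (A.filter fun v => f v ∈ S).card
    · exact ⟨S, hS, Or.inr hn⟩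
    · obtain rfl := hs.resolve_right hn
      refine ⟨insert c S, ?_, Or.inl rfl⟩
      have hsplit : (A.filter fun v => f v ∈ insert c S) =
          (A.filter fun v => f v = c) ∪ (A.filter fun v => f v ∈ S) := by
        ext v
        simp only [mem_filter, mem_union, mem_insert]
        tauto
      have hunion := card_union_le (A.filter fun v => f v = c) (A.filter fun v => f v ∈ S)
      have hc := hf c
      rw [hsplit]
      omega

/-- A set `T` separates `H` when `H \ T` carries a labelling that is constant along edges and
has fibres of size at most `|H| / 3`. -/
theorem sepUpTo_of_labelling {V ι : Type*} [DecidableEq V] (G : SimpleGraph V) (H T : Finset V)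
    (hT : T ⊆ H) (f : V → ι)
    (hadj : ∀ u ∈ H \ T, ∀ v ∈ H \ T, G.Adj u v → f u = f v)
    (hf : ∀ c, 3 * ((H \ T).filter fun v => f v = c).card ≤ H.card)
    {t : ℝ} (ht : (T.card : ℝ) ≤ t) : SepUpTo G H t := by
  obtain ⟨S, hS, hS'⟩ := exists_balanced_labels (H \ T) f H.card hf ((H \ T).image f)
  have hcard := card_filter_add_card_filter_not (s := H \ T) (fun v => f v ∈ S)
  have hle := card_le_card (sdiff_subset : H \ T ⊆ H)
  refine ⟨T, (H \ T).filter fun v => f v ∈ S, (H \ T).filter fun v => ¬ f v ∈ S,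
    ?_, ?_, ?_, ?_, ?_, hS, ?_, ht⟩
  · rw [union_assoc, filter_union_filter_not_eq, union_sdiff_of_subset hT]
  · exact disjoint_sdiff.mono_right (filter_subset _ _)
  · exact disjoint_sdiff.mono_right (filter_subset _ _)
  · exact disjoint_filter_filter_not _ _ _
  · intro a ha b hb hab
    rw [mem_filter] at ha hb
    exact hb.2 (hadj a ha.1 b hb.1 hab ▸ ha.2)
  · rcases hS' with rfl | hn
    · have : ((H \ T).filter fun v => ¬ f v ∈ (H \ T).image f) = ∅ :=
        filter_eq_empty_iff.2 fun v hv h => h (mem_image_of_mem f hv)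
      rw [this]
      simp
    · omega

theorem gridGraph_adj_dist_le {D L : ℕ} {u v : Fin D → Fin L} (h : (gridGraph D L).Adj u v)
    (i : Fin D) : Nat.dist (u i) (v i) ≤ 1 := by
  have hle : Nat.dist (u i) (v i) ≤ ∑ j, Nat.dist (u j : ℕ) (v j : ℕ) :=
    single_le_sum (f := fun j => Nat.dist (u j : ℕ) (v j : ℕ)) (fun _ _ => Nat.zero_le _)
      (mem_univ i)
  rw [gridGraph, SimpleGraph.fromRel_adj] at h
  rcases h.2 with h | h
  · exact h ▸ hle
  · simp only [Nat.dist_comm (v _ : ℕ)] at h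
    exact h ▸ hle

theorem div_eq_div_of_dist_le_one {a b s : ℕ} (h : Nat.dist a b ≤ 1) (ha : ¬ s ∣ a)
    (hb : ¬ s ∣ b) : a / s = b / s := by
  have : a = b ∨ b = a + 1 ∨ a = b + 1 := by
    unfold Nat.dist at h
    omega
  rcases this with rfl | rfl | rfl
  · rfl
  · simp [Nat.succ_div, hb]
  · simp [Nat.succ_div, ha]

/-- Some translate of the multiples of `s` meets at most a `1 / s` fraction of the values of `g`. -/
theorem exists_shift_card_dvd_le {V : Type*} (H : Finset V) (g : V → ℕ) {s : ℕ} (hs : 0 < s) :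
    ∃ k, ((H.filter fun v => s ∣ g v + k).card : ℝ) ≤ H.card / s := by
  obtain ⟨r, hr, hcard⟩ := exists_card_fiber_le_of_card_le_nsmul (s := H) (t := range s)
    (f := fun v => g v % s) (b := (H.card : ℝ) / s) ⟨0, mem_range.2 hs⟩ (by
      have : (s : ℝ) ≠ 0 := by positivity
      rw [card_range, nsmul_eq_mul, mul_div_cancel₀ _ this])
  rw [mem_range] at hr
  refine ⟨s - r, le_trans ?_ hcard⟩
  refine Nat.cast_le.2 (card_le_card fun v hv => ?_)
  rw [mem_filter] at hv ⊢
  refine ⟨hv.1, ?_⟩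
  have hmod : g v + (s - r) + r ≡ 0 + r [MOD s] :=
    Nat.ModEq.add_right r ((Nat.modEq_zero_iff_dvd).2 hv.2)
  rw [add_assoc, Nat.sub_add_cancel hr.le, zero_add, Nat.ModEq, Nat.add_mod_right,
    Nat.mod_eq_of_lt hr] at hmod
  exact hmod

theorem card_filter_block_le {D L : ℕ} (A : Finset (Fin D → Fin L)) {s : ℕ} (hs : 0 < s)
    (k c : Fin D → ℕ) :
    (A.filter fun v => (fun i => ((v i : ℕ) + k i) / s) = c).card ≤ s ^ D := by
  have h := card_le_card_of_injOn (s := A.filter fun v => (fun i => ((v i : ℕ) + k i) / s) = c)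
    (t := (univ : Finset (Fin D → Fin s)))
    (fun v i => ⟨((v i : ℕ) + k i) % s, Nat.mod_lt _ hs⟩) (fun _ _ => mem_univ _) (by
      intro u hu v hv huv
      have hu := (mem_filter.1 (mem_coe.1 hu)).2
      have hv := (mem_filter.1 (mem_coe.1 hv)).2
      ext i
      have hmod : ((u i : ℕ) + k i) % s = ((v i : ℕ) + k i) % s :=
        Fin.mk.inj (congrFun huv i)
      have hdiv : ((u i : ℕ) + k i) / s = ((v i : ℕ) + k i) / s :=
        congrFun (hu.trans hv.symm) i
      have hu' := Nat.div_add_mod ((u i : ℕ) + k i) s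
      have hv' := Nat.div_add_mod ((v i : ℕ) + k i) s
      rw [hmod, hdiv] at hu'
      omega)
  simpa using h

/-- Cutting along hyperplanes with spacing `s` separates any `H` with `3 * s ^ D ≤ |H|`. -/
theorem sepUpTo_gridGraph_of_spacing {D L s : ℕ} (hs : 0 < s) (H : Finset (Fin D → Fin L))
    (hH : 3 * s ^ D ≤ H.card) : SepUpTo (gridGraph D L) H (D * (H.card / s : ℝ)) := by
  choose k hk using fun i : Fin D => exists_shift_card_dvd_le H (fun v => (v i : ℕ)) hs
  refine sepUpTo_of_labelling (gridGraph D L) H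
    (univ.biUnion fun i => H.filter fun v => s ∣ (v i : ℕ) + k i)
    (biUnion_subset.2 fun _ _ => filter_subset _ _) (fun v i => ((v i : ℕ) + k i) / s) ?_ ?_ ?_
  · intro u hu v hv huv
    simp only [mem_sdiff, mem_biUnion, mem_filter, mem_univ, true_and, not_exists, not_and]
      at hu hv
    funext i
    refine div_eq_div_of_dist_le_one ?_ (hu.2 i hu.1) (hv.2 i hv.1)
    rw [Nat.dist_add_add_right]
    exact gridGraph_adj_dist_le huv i
  · intro c
    refine le_trans (Nat.mul_le_mul_left 3 ?_) hH
    convert card_filter_block_le _ hs k c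
  · calc ((univ.biUnion fun i => H.filter fun v => s ∣ (v i : ℕ) + k i).card : ℝ)
        ≤ ∑ i, ((H.filter fun v => s ∣ (v i : ℕ) + k i).card : ℝ) :=
          mod_cast card_biUnion_le
      _ ≤ ∑ _i : Fin D, (H.card / s : ℝ) := sum_le_sum fun i _ => hk i
      _ = D * (H.card / s : ℝ) := by simp

theorem SepUpTo.mono {V : Type*} [DecidableEq V] {G : SimpleGraph V} {H : Finset V} {t t' : ℝ}
    (h : SepUpTo G H t) (htt' : t ≤ t') : SepUpTo G H t' := by
  obtain ⟨T, U₁, U₂, h₁, h₂, h₃, h₄, h₅, h₆, h₇, h₈⟩ := h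
  exact ⟨T, U₁, U₂, h₁, h₂, h₃, h₄, h₅, h₆, h₇, h₈.trans htt'⟩

theorem sepUpTo_card {V : Type*} [DecidableEq V] (G : SimpleGraph V) (H : Finset V) :
    SepUpTo G H H.card :=
  sepUpTo_of_labelling G H H Subset.rfl id (by simp) (by simp) le_rfl

/-- A spacing of order `n ^ (1 / D)`. -/
theorem exists_spacing {D n : ℕ} (hD : 1 ≤ D) (hn : 3 ≤ n) :
    ∃ s : ℕ, 0 < s ∧ 3 * s ^ D ≤ n ∧ (n / s : ℝ) ≤ 6 * (n : ℝ) ^ (1 - 1 / (D : ℝ)) := by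
  have hn' : (3 : ℝ) ≤ n := mod_cast hn
  have hn0 : (0 : ℝ) < n := by linarith
  have hD' : (1 : ℝ) ≤ D := mod_cast hD
  set x : ℝ := ((n : ℝ) / 3) ^ (1 / (D : ℝ)) with hx
  have hx1 : 1 ≤ x := Real.one_le_rpow (by linarith) (by positivity)
  have hs : 0 < ⌊x⌋₊ := Nat.floor_pos.2 hx1
  have hs1 : (1 : ℝ) ≤ ⌊x⌋₊ := mod_cast hs
  refine ⟨⌊x⌋₊, hs, ?_, ?_⟩
  · have hle : (⌊x⌋₊ : ℝ) ^ D ≤ x ^ D :=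
      pow_le_pow_left₀ (by positivity) (Nat.floor_le (by linarith)) D
    have hpow : x ^ D = n / 3 := by
      rw [hx, one_div, Real.rpow_inv_natCast_pow (by positivity) (by omega)]
    have : 3 * (⌊x⌋₊ : ℝ) ^ D ≤ n := by linarith
    exact_mod_cast this
  · have hfloor : x < ⌊x⌋₊ + 1 := Nat.lt_floor_add_one x
    have h3 : (3 : ℝ) ^ (1 / (D : ℝ)) ≤ 3 := by
      simpa using Real.rpow_le_rpow_of_exponent_le (x := 3) (by norm_num)
        (div_le_one_of_le₀ hD' (by positivity))
    have hroot : (n : ℝ) ^ (1 / (D : ℝ)) ≤ 3 * x := by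
      calc (n : ℝ) ^ (1 / (D : ℝ)) = (3 * (n / 3 : ℝ)) ^ (1 / (D : ℝ)) := by
            congr 1
            ring
        _ = 3 ^ (1 / (D : ℝ)) * x := Real.mul_rpow (by norm_num) (by positivity)
        _ ≤ 3 * x := by gcongr
    rw [div_le_iff₀ (by linarith)]
    have hpos : (0 : ℝ) < (n : ℝ) ^ (1 - 1 / (D : ℝ)) := by positivity
    calc (n : ℝ) = (n : ℝ) ^ (1 - 1 / (D : ℝ)) * (n : ℝ) ^ (1 / (D : ℝ)) := by
          rw [← Real.rpow_add hn0, sub_add_cancel, Real.rpow_one]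
      _ ≤ (n : ℝ) ^ (1 - 1 / (D : ℝ)) * (6 * ⌊x⌋₊) := by
          gcongr
          linarith
      _ = 6 * (n : ℝ) ^ (1 - 1 / (D : ℝ)) * ⌊x⌋₊ := by ring

theorem sepUpTo_gridGraph {D : ℕ} (hD : 1 ≤ D) (L : ℕ) (H : Finset (Fin D → Fin L)) :
    SepUpTo (gridGraph D L) H (6 * D * (H.card : ℝ) ^ (1 - 1 / (D : ℝ))) := by
  have hD' : (1 : ℝ) ≤ D := mod_cast hD
  by_cases hn : 3 ≤ H.card
  · obtain ⟨s, hs, hsn, hle⟩ := exists_spacing hD hn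
    refine (sepUpTo_gridGraph_of_spacing hs H hsn).mono ?_
    calc (D : ℝ) * (H.card / s) ≤ D * (6 * (H.card : ℝ) ^ (1 - 1 / (D : ℝ))) := by gcongr
      _ = 6 * D * (H.card : ℝ) ^ (1 - 1 / (D : ℝ)) := by ring
  · refine (sepUpTo_card _ H).mono ?_
    rcases Nat.eq_zero_or_pos H.card with h0 | hpos
    · rw [h0]
      simp only [Nat.cast_zero]
      positivity
    · have hpow : (1 : ℝ) ≤ (H.card : ℝ) ^ (1 - 1 / (D : ℝ)) :=
        Real.one_le_rpow (mod_cast hpos)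
          (sub_nonneg.2 (div_le_one_of_le₀ hD' (by positivity)))
      have h2 : (H.card : ℝ) ≤ 2 := mod_cast (by omega : H.card ≤ 2)
      nlinarith

/-- The 2-dimensional `L × L` grid has separation profile `O(√r)`, and more
generally the `D`-dimensional grid of side `L` has separation profile `O(r^{1−1/D})`. -/
theorem grid_separation_profile :
    (∃ γ : ℝ, 0 < γ ∧ ∀ L : ℕ, ∀ H : Finset (Fin 2 → Fin L),
      SepUpTo (gridGraph 2 L) H (γ * Real.sqrt (H.card : ℝ))) ∧
    (∀ D : ℕ, 1 ≤ D → ∃ γ : ℝ, 0 < γ ∧ ∀ L : ℕ, ∀ H : Finset (Fin D → Fin L),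
      SepUpTo (gridGraph D L) H (γ * ((H.card : ℝ) ^ (1 - 1 / (D : ℝ))))) := by
  refine ⟨⟨6 * (2 : ℕ), by norm_num, fun L H => ?_⟩, fun D hD =>
    ⟨6 * D, by positivity, fun L H => ?_⟩⟩
  · have h := sepUpTo_gridGraph one_le_two L H
    rw [show (1 - 1 / ((2 : ℕ) : ℝ) : ℝ) = 1 / 2 by norm_num, ← Real.sqrt_eq_rpow] at h
    convert h
  · convert sepUpTo_gridGraph hD L H
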